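/- Assume Case 3. Then: (1) for every t ≥ 98, (s_(t+1,178),…,s_(t+1,288)) = (s_(t,264) + b_{t+1}, s_(t,178),…,s_(t,287)); (2) b has period 78, i.e. b_{i+78} = b_i for every integer i. -/

import Mathlib

/-- A Trivium state: we use coordinates 1,…,288 of a function `ℕ → ZMod 2`. -/
abbrev TState := ℕ → ZMod 2

/-- The Trivium state-renewal map `T`. -/
def trivT (s : TState) : TState := fun j =>
  if j = 1 then s 243 + s 286 * s 287 + s 288 + s 69
  else if j ≤ 93 then s (j - 1)
  else if j = 94 then s 66 + s 91 * s 92 + s 93 + s 171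
  else if j ≤ 177 then s (j - 1)
  else if j = 178 then s 162 + s 175 * s 176 + s 177 + s 264
  else if j ≤ 288 then s (j - 1)
  else 0

/-- `Z_F`: set every coordinate with index in `F` to zero. -/
def zapF (F : Finset ℕ) (s : TState) : TState := fun j => if j ∈ F then 0 else s j

/-- The loading state `L(k, IV)`: positions 1–93 are `(k_1,…,k_80,0,…,0)`,
positions 94–177 are `(IV_1,…,IV_80,0,0,0,0)`, positions 178–288 are `(0,…,0,1,1,1)`. -/
def loadIV (k IV : TState) : TState := fun j =>
  if j = 0 then 0
  else if j ≤ 80 then k j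
  else if j ≤ 93 then 0
  else if j ≤ 173 then IV (j - 93)
  else if j ≤ 285 then 0
  else if j ≤ 288 then 1
  else 0

/-- The fault-injected trajectory with initial vector `IV`:
`s^(0) = Z_F(L(k,IV))`, `s^(t+1) = Z_F(T(s^(t)))`. -/
def trajIV (F : Finset ℕ) (k IV : TState) : ℕ → TState
  | 0 => zapF F (loadIV k IV)
  | t + 1 => zapF F (trivT (trajIV F k IV t))

/-- The fault-injected trajectory with `IV = 0`. -/
def traj (F : Finset ℕ) (k : TState) : ℕ → TState := trajIV F k (fun _ => 0)

/-- The key-stream with initial vector `IV`. -/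
def ksIV (F : Finset ℕ) (k IV : TState) (m : ℕ) : ZMod 2 :=
  trajIV F k IV (m + 1152) 66 + trajIV F k IV (m + 1152) 93 + trajIV F k IV (m + 1152) 162 +
    trajIV F k IV (m + 1152) 177 + trajIV F k IV (m + 1152) 243 + trajIV F k IV (m + 1152) 288

/-- The key-stream with `IV = 0`. -/
def ks (F : Finset ℕ) (k : TState) : ℕ → ZMod 2 := ksIV F k (fun _ => 0)

/-- `e_j` for `1 ≤ j ≤ 69`: `e_j = k_j` for `j ≤ 66`, `e_67 = k_67+1`, `e_68 = k_68+1`,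
`e_69 = k_69`. -/
def ebase (k : TState) : ℕ → ZMod 2 := fun j =>
  if j ≤ 66 then k j else if j = 67 then k 67 + 1 else if j = 68 then k 68 + 1 else k 69

/-- `e` extended to all integer indices periodically with period 69. -/
def eper (k : TState) (i : ℤ) : ZMod 2 := ebase k (((i - 1).emod 69).toNat + 1)

/-- `a_n = s_(n-1,66) + s_(n-1,91)·s_(n-1,92) + s_(n-1,93)` for a natural number `n`. -/
def aAt (F : Finset ℕ) (k : TState) (n : ℕ) : ZMod 2 :=
  traj F k (n - 1) 66 + traj F k (n - 1) 91 * traj F k (n - 1) 92 + traj F k (n - 1) 93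

/-- The sequence `a_i` for integer `i`: `a_{t+1} = s_(t,66)+s_(t,91)s_(t,92)+s_(t,93)` for
`t ≥ 27`, and for `i ≤ 27`, `a_i = a_j` where `28 ≤ j ≤ 96` and `j ≡ i (mod 69)`. -/
def aFun (F : Finset ℕ) (k : TState) (i : ℤ) : ZMod 2 :=
  if 28 ≤ i then aAt F k i.toNat else aAt F k (28 + (i - 28).emod 69).toNat

/-- `b_n = s_(n-1,162) + s_(n-1,175)·s_(n-1,176) + s_(n-1,177)` for a natural number `n`. -/
def bAt (F : Finset ℕ) (k : TState) (n : ℕ) : ZMod 2 :=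
  traj F k (n - 1) 162 + traj F k (n - 1) 175 * traj F k (n - 1) 176 + traj F k (n - 1) 177

/-- The sequence `b_i` for integer `i`: `b_{t+1} = s_(t,162)+s_(t,175)s_(t,176)+s_(t,177)` for
`t ≥ 98`, and for `i ≤ 98`, `b_i = b_j` where `99 ≤ j ≤ 176` and `j ≡ i (mod 78)`. -/
def bFun (F : Finset ℕ) (k : TState) (i : ℤ) : ZMod 2 :=
  if 99 ≤ i then bAt F k i.toNat else bAt F k (99 + (i - 99).emod 78).toNat

/-- The changed state at time 27 (Case 2, Lemma 6): coordinates 172–177 are replaced by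
`s_(27,94)+a_27, …, s_(27,99)+a_22`; all other coordinates agree with `s^(27)`. -/
def sTildeBase (F : Finset ℕ) (k : TState) : TState := fun j =>
  if 172 ≤ j ∧ j ≤ 177 then traj F k 27 (j - 78) + aFun F k (199 - (j : ℤ))
  else traj F k 27 j

/-- The changed trajectory `s̃`: `s̃^(27)` is the changed state, and
`s̃^(t+1) = Z_F(T(s̃^(t)))` for `t ≥ 27`. (For `t ≤ 27`, `sTilde F k t = s̃^(27)`.) -/
def sTilde (F : Finset ℕ) (k : TState) (t : ℕ) : TState :=
  (fun s => zapF F (trivT s))^[t - 27] (sTildeBase F k)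

/-- The changed state at time 98 (Case 3, Lemma 11): coordinates 265–288 are replaced by
`s_(98,178)+b_98, …, s_(98,201)+b_75`; all other coordinates agree with `s^(98)`. -/
def sHatBase (F : Finset ℕ) (k : TState) : TState := fun j =>
  if 265 ≤ j ∧ j ≤ 288 then traj F k 98 (j - 87) + bFun F k (363 - (j : ℤ))
  else traj F k 98 j

/-- The changed trajectory `ŝ`: `ŝ^(98)` is the changed state, and
`ŝ^(t+1) = Z_F(T(ŝ^(t)))` for `t ≥ 98`. (For `t ≤ 98`, `sHat F k t = ŝ^(98)`.) -/
def sHat (F : Finset ℕ) (k : TState) (t : ℕ) : TState :=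
  (fun s => zapF F (trivT s))^[t - 98] (sHatBase F k)

/-- `aSeq t = a_{t+1} = s_(t,66) + s_(t,91)·s_(t,92) + s_(t,93)` for `t ≥ 0`. -/
def aSeq (F : Finset ℕ) (k : TState) (t : ℕ) : ZMod 2 :=
  traj F k t 66 + traj F k t 91 * traj F k t 92 + traj F k t 93

theorem traj_succ (F : Finset ℕ) (k : TState) (t j : ℕ) :
    traj F k (t + 1) j = if j ∈ F then 0 else trivT (traj F k t) j := rfl

theorem traj_eq_zero_of_mem {F : Finset ℕ} (k : TState) {p : ℕ} (hp : p ∈ F) (t : ℕ) :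
    traj F k t p = 0 := by
  cases t <;> exact if_pos hp

/-- A hard fault at `p` propagates through the rest of the first register. -/
theorem traj_eq_zero_of_fault {F : Finset ℕ} (k : TState) {p : ℕ} (hp : p ∈ F) (hp1 : 1 ≤ p)
    (m t : ℕ) (hm : p + m ≤ 93) (ht : m ≤ t) : traj F k t (p + m) = 0 := by
  induction m generalizing t with
  | zero => exact traj_eq_zero_of_mem k hp t
  | succ m ih =>
    obtain ⟨t, rfl⟩ : ∃ u, t = u + 1 := ⟨t - 1, by omega⟩
    rw [traj_succ]
    split_ifs
    · rfl
    · rw [trivT, if_neg (by omega), if_pos hm]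
      exact ih t (by omega) (by omega)

theorem notMem_of_subset_Icc {F : Finset ℕ} (hsub : F ⊆ Finset.Icc 1 93) {j : ℕ} (hj : 93 < j) :
    j ∉ F := fun h => by
  have := Finset.mem_Icc.1 (hsub h)
  omega

theorem traj_succ_second_register {F : Finset ℕ} (k : TState) (hsub : F ⊆ Finset.Icc 1 93)
    (t j : ℕ) (h1 : 94 ≤ j) (h2 : j < 177) : traj F k (t + 1) (j + 1) = traj F k t j := by
  rw [traj_succ, if_neg (notMem_of_subset_Icc hsub (by omega)), trivT, if_neg (by omega),
    if_neg (by omega), if_neg (by omega), if_pos (by omega), Nat.add_sub_cancel]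

theorem traj_add_second_register {F : Finset ℕ} (k : TState) (hsub : F ⊆ Finset.Icc 1 93)
    (m t j : ℕ) (h1 : 94 ≤ j) (h2 : j + m ≤ 177) : traj F k (t + m) (j + m) = traj F k t j := by
  induction m with
  | zero => rfl
  | succ m ih =>
    rw [← add_assoc, ← add_assoc, traj_succ_second_register k hsub _ _ (by omega) (by omega)]
    exact ih (by omega)

/-- Once the first register has been cleared from position `66` on, the second register is a
cyclic shift of length `78`. -/
theorem traj_succ_94 {F : Finset ℕ} (k : TState) (hsub : F ⊆ Finset.Icc 1 93) {p : ℕ}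
    (hp : p ∈ F) (hp66 : p ≤ 66) (t : ℕ) (ht : 92 ≤ t) :
    traj F k (t + 1) 94 = traj F k t 171 := by
  have hp1 : 1 ≤ p := (Finset.mem_Icc.1 (hsub hp)).1
  have zero (j : ℕ) (h1 : 66 ≤ j) (h2 : j ≤ 93) : traj F k t j = 0 := by
    have := traj_eq_zero_of_fault k hp hp1 (j - p) t (by omega) (by omega)
    rwa [Nat.add_sub_cancel' (by omega)] at this
  rw [traj_succ, if_neg (notMem_of_subset_Icc hsub (by omega))]
  simp [trivT, zero 66, zero 91, zero 93]

theorem traj_add_78 {F : Finset ℕ} (k : TState) (hsub : F ⊆ Finset.Icc 1 93) {p : ℕ}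
    (hp : p ∈ F) (hp66 : p ≤ 66) (t j : ℕ) (ht : 98 ≤ t) (h1 : 162 ≤ j) (h2 : j ≤ 177) :
    traj F k (t + 78) j = traj F k t j := by
  obtain ⟨u, hu⟩ : ∃ u, t + 171 = u + j := ⟨t + 171 - j, by omega⟩
  have e1 : traj F k (t + 78) j = traj F k (u + 1) 94 := by
    have := traj_add_second_register k hsub (j - 94) (u + 1) 94 (by omega) (by omega)
    rwa [show u + 1 + (j - 94) = t + 78 by omega, show 94 + (j - 94) = j by omega] at this
  rw [e1, traj_succ_94 k hsub hp hp66 u (by omega)]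
  rcases le_total j 171 with h | h
  · have := traj_add_second_register k hsub (171 - j) t j (by omega) (by omega)
    rwa [show t + (171 - j) = u by omega, show j + (171 - j) = 171 by omega] at this
  · have := traj_add_second_register k hsub (j - 171) u 171 (by omega) (by omega)
    rw [show u + (j - 171) = t by omega, show 171 + (j - 171) = j by omega] at this
    exact this.symm

theorem bAt_add_78 {F : Finset ℕ} (k : TState) (hsub : F ⊆ Finset.Icc 1 93) {p : ℕ}
    (hp : p ∈ F) (hp66 : p ≤ 66) (n : ℕ) (hn : 99 ≤ n) : bAt F k (n + 78) = bAt F k n := by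
  have h (j : ℕ) (h1 : 162 ≤ j) (h2 : j ≤ 177) :
      traj F k (n + 78 - 1) j = traj F k (n - 1) j := by
    rw [show n + 78 - 1 = n - 1 + 78 by omega]
    exact traj_add_78 k hsub hp hp66 (n - 1) j (by omega) h1 h2
  rw [bAt, bAt, h 162, h 175, h 176, h 177] <;> omega

theorem bFun_of_le (F : Finset ℕ) (k : TState) (i : ℤ) (hi : 99 ≤ i) :
    bFun F k i = bAt F k i.toNat := if_pos hi

theorem bFun_of_lt (F : Finset ℕ) (k : TState) (i : ℤ) (hi : i < 99) :
    bFun F k i = bAt F k (99 + (i - 99) % 78).toNat := if_neg (not_le.2 hi)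

/-- Lemma 10 (Case 3). -/
theorem case3_b_sequence (k : TState) (F : Finset ℕ) (hF : F.Nonempty)
    (hsub : F ⊆ Finset.Icc 1 93)
    (hlo : 1 ≤ F.min' hF) (hhi : F.min' hF ≤ 66) :
    (∀ t, 98 ≤ t →
        traj F k (t + 1) 178 = traj F k t 264 + bFun F k ((t : ℤ) + 1) ∧
        (∀ j, 179 ≤ j → j ≤ 288 → traj F k (t + 1) j = traj F k t (j - 1))) ∧
    (∀ i : ℤ, bFun F k (i + 78) = bFun F k i) := by
  have hp := F.min'_mem hF
  refine ⟨fun t ht => ⟨?_, fun j h1 h2 => ?_⟩, fun i => ?_⟩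
  · rw [traj_succ, if_neg (notMem_of_subset_Icc hsub (by omega)), bFun_of_le _ _ _ (by omega),
      show ((t : ℤ) + 1).toNat = t + 1 by omega]
    simp [trivT, bAt, add_comm]
  · rw [traj_succ, if_neg (notMem_of_subset_Icc hsub (by omega)), trivT, if_neg (by omega),
      if_neg (by omega), if_neg (by omega), if_neg (by omega), if_neg (by omega), if_pos h2]
  · rcases le_or_gt 99 i with hi | hi
    · rw [bFun_of_le _ _ _ hi, bFun_of_le _ _ _ (by omega),
        show (i + 78).toNat = i.toNat + 78 by omega]
      exact bAt_add_78 k hsub hp hhi _ (by omega)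
    · rw [bFun_of_lt _ _ _ hi]
      rcases le_or_gt 99 (i + 78) with hi' | hi'
      · rw [bFun_of_le _ _ _ hi']
        congr 1
        omega
      · rw [bFun_of_lt _ _ _ hi']
        congr 1
        omega
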